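/- Let f:U→ℝ^n be a C² map of the Monge form on an open set U⊂ℝ^d with n=d+m and with first and second partial derivatives bounded on U, and let θ∈ℝ^n. Then there is a constant C>0 depending on n and f such that for every ε∈(0,1), every ball B⊂U and all sufficiently large t>0: N_θ(B ∖ 𝔐(ε,t); ε, t) ≤ C·ε^m e^{(d+1)t} L_d(B). -/

import Mathlib

open MeasureTheory Filter Set
open scoped ENNReal NNReal

noncomputable section

/-- The set `S_n^θ(ψ)` of `(ψ,θ)`-approximable points of `ℝ^n` (sup norm on `Fin n → ℝ`):
points `x` with `‖x - (p+θ)/q‖ ≤ ψ q / q` for infinitely many `(p,q) ∈ ℤ^n × ℕ`. -/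
def SApprox (n : ℕ) (θ : Fin n → ℝ) (ψ : ℝ → ℝ) : Set (Fin n → ℝ) :=
  {x | {pq : (Fin n → ℤ) × ℕ | 0 < pq.2 ∧
    ‖(fun i => x i - ((pq.1 i : ℝ) + θ i) / (pq.2 : ℝ) : Fin n → ℝ)‖ ≤
      ψ (pq.2 : ℝ) / (pq.2 : ℝ)}.Infinite}

/-- Iterated partial derivatives along a list of coordinate directions. -/
def listPDeriv {d n : ℕ} : List (Fin d) → ((Fin d → ℝ) → (Fin n → ℝ)) → ((Fin d → ℝ) → (Fin n → ℝ))
  | [], f => f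
  | i :: is, f => fun x => fderiv ℝ (listPDeriv is f) x (Pi.single i 1)

/-- `f` is `l`-nondegenerate at `x`: `f` is `C^l` near `x` and the partial derivatives of `f`
at `x` of orders `1,…,l` span `ℝ^n`. -/
def IsLNondegenerateAt {d n : ℕ} (l : ℕ) (f : (Fin d → ℝ) → (Fin n → ℝ)) (x : Fin d → ℝ) : Prop :=
  (∃ V ∈ nhds x, ContDiffOn ℝ l f V) ∧
  Submodule.span ℝ {v : Fin n → ℝ | ∃ β : List (Fin d),
    1 ≤ β.length ∧ β.length ≤ l ∧ v = listPDeriv β f x} = ⊤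

def IsNondegenerateAt {d n : ℕ} (f : (Fin d → ℝ) → (Fin n → ℝ)) (x : Fin d → ℝ) : Prop :=
  ∃ l : ℕ, IsLNondegenerateAt l f x

/-- `f` is nondegenerate in `U`: nondegenerate at almost every point of `U`. -/
def IsNondegenerateIn {d n : ℕ} (f : (Fin d → ℝ) → (Fin n → ℝ)) (U : Set (Fin d → ℝ)) : Prop :=
  ∀ᵐ x ∂(volume : Measure (Fin d → ℝ)), x ∈ U → IsNondegenerateAt f x

/-- `f` is nonsingular on `U`: its Jacobian has rank `d` at every point of `U`. -/
def IsNonsingularOn {d n : ℕ} (f : (Fin d → ℝ) → (Fin n → ℝ)) (U : Set (Fin d → ℝ)) : Prop :=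
  ∀ x ∈ U, LinearMap.rank (fderiv ℝ f x).toLinearMap = (d : Cardinal)

/-- `η(n,d)`. -/
def etaND (n d : ℕ) : ℝ := if 1 < d then 1 / ((n : ℝ) - 1) else 3 / (2 * (n : ℝ) - 1)

/-- The set counted by `N*_θ(Δ;ε,t)`. -/
def NstarSet {d n : ℕ} (f : (Fin d → ℝ) → Fin n → ℝ) (θ : Fin n → ℝ)
    (Δ : Set (Fin d → ℝ)) (ε t : ℝ) : Set ((Fin n → ℤ) × ℤ) :=
  {pq | Real.exp (t - 1) ≤ (pq.2 : ℝ) ∧ (pq.2 : ℝ) ≤ Real.exp t ∧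
    sInf ((fun x => ‖(fun i => f x i - ((pq.1 i : ℝ) + θ i) / (pq.2 : ℝ) : Fin n → ℝ)‖) '' Δ)
      ≤ ε / Real.exp t}

/-- `N*_θ(Δ;ε,t)`. -/
def Nstar {d n : ℕ} (f : (Fin d → ℝ) → Fin n → ℝ) (θ : Fin n → ℝ)
    (Δ : Set (Fin d → ℝ)) (ε t : ℝ) : ℕ := (NstarSet f θ Δ ε t).ncard

/-- The set counted by `N_θ(Δ;ε,t)` (with `1 ≤ q ≤ e^t`). -/
def NfullSet {d n : ℕ} (f : (Fin d → ℝ) → Fin n → ℝ) (θ : Fin n → ℝ)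
    (Δ : Set (Fin d → ℝ)) (ε t : ℝ) : Set ((Fin n → ℤ) × ℤ) :=
  {pq | 1 ≤ pq.2 ∧ (pq.2 : ℝ) ≤ Real.exp t ∧
    sInf ((fun x => ‖(fun i => f x i - ((pq.1 i : ℝ) + θ i) / (pq.2 : ℝ) : Fin n → ℝ)‖) '' Δ)
      ≤ ε / Real.exp t}

/-- `N_θ(Δ;ε,t)`. -/
def Nfull {d n : ℕ} (f : (Fin d → ℝ) → Fin n → ℝ) (θ : Fin n → ℝ)
    (Δ : Set (Fin d → ℝ)) (ε t : ℝ) : ℕ := (NfullSet f θ Δ ε t).ncard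

/-- Sup norm of the gradient of a scalar function on `ℝ^d`. -/
def gradSupNorm {d : ℕ} (g : (Fin d → ℝ) → ℝ) (x : Fin d → ℝ) : ℝ :=
  ‖(fun j : Fin d => fderiv ℝ g x (Pi.single j 1) : Fin d → ℝ)‖

/-- The set `𝔖_f(δ,K,T)`. -/
def SfrakSet {d n : ℕ} (U : Set (Fin d → ℝ)) (f : (Fin d → ℝ) → Fin n → ℝ)
    (δ K : ℝ) (T : Fin n → ℝ) : Set (Fin d → ℝ) :=
  {x | x ∈ U ∧ ∃ a₀ : ℤ, ∃ a : Fin n → ℤ, a ≠ 0 ∧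
    |(a₀ : ℝ) + ∑ i, f x i * (a i : ℝ)| < δ ∧
    gradSupNorm (fun y => ∑ i, f y i * (a i : ℝ)) x < K ∧
    ∀ i, |(a i : ℝ)| < T i}

/-- First-order partial derivative `∂_i f_j` (0-based indices as naturals; junk value 0
out of range). -/
def pd1 {d m : ℕ} (f : (Fin d → ℝ) → Fin m → ℝ) (i j : ℕ) (x : Fin d → ℝ) : ℝ :=
  if h : i < d ∧ j < m then
    fderiv ℝ (fun y => f y ⟨j, h.2⟩) x (Pi.single (⟨i, h.1⟩ : Fin d) 1)
  else 0

/-- Second-order partial derivative `∂_{i'} ∂_i f_j`. -/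
def pd2 {d m : ℕ} (f : (Fin d → ℝ) → Fin m → ℝ) (i i' j : ℕ) (x : Fin d → ℝ) : ℝ :=
  if h : i' < d then fderiv ℝ (fun y => pd1 f i j y) x (Pi.single (⟨i', h⟩ : Fin d) 1) else 0

/-- The Monge map `x ↦ (x, f(x)) : ℝ^d → ℝ^{d+m}`. -/
def fullMap (d m : ℕ) (f : (Fin d → ℝ) → Fin m → ℝ) : (Fin d → ℝ) → Fin (d + m) → ℝ :=
  fun x i => if h : (i : ℕ) < d then x ⟨(i : ℕ), h⟩
    else f x ⟨(i : ℕ) - d, by have := i.isLt; omega⟩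

/-- The `i`-th Minkowski successive minimum (w.r.t. the closed unit Euclidean ball) of the
lattice `g ℤ^k`. -/
def succMin {k : ℕ} (i : ℕ) (g : Matrix (Fin k) (Fin k) ℝ) : ℝ :=
  sInf {r : ℝ | 0 ≤ r ∧ i ≤ Module.finrank ℝ
    (Submodule.span ℝ {w : Fin k → ℝ | (∃ v : Fin k → ℤ, v ≠ 0 ∧
      w = g.mulVec (fun j => (v j : ℝ))) ∧ Real.sqrt (∑ j, w j ^ 2) ≤ r})}

/-- The unipotent matrix `u₁(x) ∈ SL_{n+1}(ℝ)`, `n = d+m`. -/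
def u1Mat {d m : ℕ} (f : (Fin d → ℝ) → Fin m → ℝ) (x : Fin d → ℝ) :
    Matrix (Fin (d + m + 1)) (Fin (d + m + 1)) ℝ := fun r c =>
  if (r : ℕ) = (c : ℕ) then 1
  else if (r : ℕ) < m ∧ m ≤ (c : ℕ) ∧ (c : ℕ) < d + m then
    - pd1 f (d + m - 1 - (c : ℕ)) (m - 1 - (r : ℕ)) x
  else if (r : ℕ) < m ∧ (c : ℕ) = d + m then
    (if h : m - 1 - (r : ℕ) < m then f x ⟨m - 1 - (r : ℕ), h⟩ else 0)
      - ∑ i : Fin d, x i * pd1 f (i : ℕ) (m - 1 - (r : ℕ)) x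
  else if m ≤ (r : ℕ) ∧ (r : ℕ) < d + m ∧ (c : ℕ) = d + m then
    (if h : d + m - 1 - (r : ℕ) < d then x ⟨d + m - 1 - (r : ℕ), h⟩ else 0)
  else 0

/-- The inverse `a_{ε,t,v}⁻¹` of the diagonal matrix `a_{ε,t,v}`. -/
def aInvMat (d m : ℕ) (ε t v : ℝ) : Matrix (Fin (d + m + 1)) (Fin (d + m + 1)) ℝ :=
  Matrix.diagonal (fun i => v * (if (i : ℕ) < m then ε⁻¹
    else if (i : ℕ) < d + m then (ε ^ m * Real.exp t) ^ ((1 : ℝ) / d)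
    else (v ^ (d + m + 1) * Real.exp t)⁻¹))

/-- The set `𝔊(v,t,ε)`. -/
def Gfrak {d m : ℕ} (U : Set (Fin d → ℝ)) (f : (Fin d → ℝ) → Fin m → ℝ)
    (v t ε : ℝ) : Set (Fin d → ℝ) :=
  {x | x ∈ U ∧ v ≤ succMin 1 (aInvMat d m ε t v * u1Mat f x)}

/-- The set `𝒩_θ(t,ε,B)`. -/
def NCal {d m : ℕ} (f : (Fin d → ℝ) → Fin m → ℝ) (θ : Fin (d + m) → ℝ)
    (t : ℕ) (ε : ℝ) (B : Set (Fin d → ℝ)) : Set (ℕ × (Fin d → ℤ) × (Fin m → ℤ)) :=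
  {q | 0 < q.1 ∧
    (fun i => ((q.2.1 i : ℝ) + θ (Fin.castAdd m i)) / (q.1 : ℝ)) ∈ B ∧
    Real.exp ((t : ℝ) - 1) ≤ (q.1 : ℝ) ∧ (q.1 : ℝ) ≤ Real.exp t ∧
    ‖(fun j => (q.1 : ℝ) * f (fun i => ((q.2.1 i : ℝ) + θ (Fin.castAdd m i)) / (q.1 : ℝ)) j
        - θ (Fin.natAdd d j) - (q.2.2 j : ℝ) : Fin m → ℝ)‖ ≤ ε}

/-- The set `Δ_θ(t,ε,B,ρ)`. -/
def DeltaCal {d m : ℕ} (f : (Fin d → ℝ) → Fin m → ℝ) (θ : Fin (d + m) → ℝ)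
    (t : ℕ) (ε : ℝ) (B : Set (Fin d → ℝ)) (ρ : ℝ) : Set (Fin d → ℝ) :=
  ⋃ q ∈ NCal f θ t ε B,
    Metric.ball (fun i => ((q.2.1 i : ℝ) + θ (Fin.castAdd m i)) / (q.1 : ℝ)) ρ

/-- `φ = (ε^n e^t)^{1/(n+1)}`, `n = d+m`. -/
def phiC (d m : ℕ) (ε t : ℝ) : ℝ := (ε ^ (d + m) * Real.exp t) ^ ((1 : ℝ) / (d + m + 1))

/-- `h = dt/(2(n+1))`. -/
def hC (d m : ℕ) (t : ℝ) : ℝ := (d : ℝ) * t / (2 * ((d : ℝ) + m + 1))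

def gMat (d m : ℕ) (ε t : ℝ) : Matrix (Fin (d + m + 1)) (Fin (d + m + 1)) ℝ :=
  Matrix.diagonal (fun i => phiC d m ε t *
    (if (i : ℕ) < d + m then ε⁻¹ else Real.exp (-t)))

def bMat (d m : ℕ) (t : ℝ) : Matrix (Fin (d + m + 1)) (Fin (d + m + 1)) ℝ :=
  Matrix.diagonal (fun i => if (i : ℕ) < m then Real.exp (hC d m t)
    else if (i : ℕ) < d + m then Real.exp (-(((m : ℝ) + 1) * t) / (2 * ((d : ℝ) + m + 1)))
    else Real.exp (hC d m t))

def dMat (d m : ℕ) (ε : ℝ) : Matrix (Fin (d + m + 1)) (Fin (d + m + 1)) ℝ :=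
  Matrix.diagonal (fun i => if (i : ℕ) < m then 1
    else if (i : ℕ) < d + m then Real.sqrt ε else 1)

/-- The raw nongeneric set `𝔐₀(ε,t)`. -/
def M0frak {d m : ℕ} (U : Set (Fin d → ℝ)) (f : (Fin d → ℝ) → Fin m → ℝ)
    (ε t : ℝ) : Set (Fin d → ℝ) :=
  {x | x ∈ U ∧ phiC d m ε t * Real.exp (hC d m t) <
    succMin (d + m + 1) (dMat d m ε * bMat d m t * gMat d m ε t * u1Mat f x)}

/-- The nongeneric (special) set `𝔐(ε,t)`. -/
def Mfrak {d m : ℕ} (U : Set (Fin d → ℝ)) (f : (Fin d → ℝ) → Fin m → ℝ)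
    (ε t : ℝ) : Set (Fin d → ℝ) :=
  (⋃ x ∈ M0frak U f ε t, Metric.ball x (Real.sqrt ε * Real.exp (-t / 2))) ∩ U

/-- The inhomogeneous Diophantine exponent `λ_n^θ(x)` of `(x,x²,…,x^n)`, as a value
in `[0,∞]`. -/
def lambdaN (n : ℕ) (θ : Fin n → ℝ) (x : ℝ) : ℝ≥0∞ :=
  sSup {lam : ℝ≥0∞ | ∃ τ : ℝ, lam = ENNReal.ofReal τ ∧
    (fun i : Fin n => x ^ ((i : ℕ) + 1)) ∈ SApprox n θ (fun q => q ^ (-τ))}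

end


open scoped Pointwise in
lemma aux_count_lattice {k : ℕ} (b : Module.Basis (Fin k) ℝ (Fin k → ℝ)) (R K : ℝ) (hR : 0 ≤ R)
    (hK : 0 ≤ K) (S : Set (Fin k → ℝ))
    (hS : ∀ w ∈ S, w ∈ Submodule.span ℤ (Set.range b) ∧ ‖w‖ ≤ R)
    (hspan : Submodule.span ℝ S = ⊤) (c : Fin k → ℝ)
    (T : Finset (Submodule.span ℤ (Set.range b)))
    (hT : ∀ v ∈ T, ‖(v : Fin k → ℝ) - c‖ ≤ K * R) :
    (T.card : ℝ) * |(Matrix.of b).det| ≤ (2 * ((K + k) * R)) ^ k := by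
  classical
  set b' := Module.Basis.ofSpan hspan.ge with hb'
  have hb'S : ∀ i, b' i ∈ S := fun i => Module.Basis.ofSpan_subset hspan.ge ⟨i, rfl⟩
  have := Module.Finite.finite_basis b'
  have := Fintype.ofFinite ((linearIndepOn_empty ℝ id).extend (Set.empty_subset S))
  have hcard : Fintype.card ((linearIndepOn_empty ℝ id).extend (Set.empty_subset S)) = k := by
    rw [← Module.finrank_eq_card_basis b']; simp
  have hle : Submodule.span ℤ (Set.range b') ≤ Submodule.span ℤ (Set.range b) := by
    rw [Submodule.span_le]
    rintro _ ⟨i, rfl⟩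
    exact (hS _ (hb'S i)).1
  have hr0 : 0 ≤ (K + k) * R := by positivity
  set E := Metric.closedBall c ((K + k) * R) with hE
  set F := ZSpan.fundamentalDomain b with hF
  have hFm : MeasurableSet F := ZSpan.fundamentalDomain_measurableSet b
  have : VAddInvariantMeasure (Submodule.span ℤ (Set.range b)) (Fin k → ℝ) volume :=
    inferInstanceAs <| VAddInvariantMeasure (Submodule.span ℤ (Set.range b)).toAddSubgroup
      (Fin k → ℝ) volume
  have key := (ZSpan.isAddFundamentalDomain b (volume : Measure (Fin k → ℝ))).measure_eq_tsum E
  have hEm : ∀ g : Submodule.span ℤ (Set.range b), MeasurableSet (g +ᵥ E) := fun g =>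
    (Metric.isClosed_closedBall.vadd g).measurableSet
  have h1 : volume E = ∫⁻ x in F, ∑' g : Submodule.span ℤ (Set.range b),
      (g +ᵥ E).indicator (fun _ => (1:ℝ≥0∞)) x := by
    rw [key, lintegral_tsum]
    · refine tsum_congr fun g => ?_
      rw [lintegral_indicator (hEm g), setLIntegral_one, Measure.restrict_apply (hEm g)]
    · intro g
      exact (measurable_const.indicator (hEm g)).aemeasurable
  have h2 : (T.card : ℝ≥0∞) * volume F ≤ volume E := by
    rw [h1, ← setLIntegral_const]
    refine lintegral_mono fun x => ?_
    set l : Submodule.span ℤ (Set.range b) := ⟨ZSpan.floor b' x, hle (ZSpan.floor b' x).2⟩ with hl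
    have hm : ‖x - l‖ ≤ k * R := by
      have := ZSpan.norm_fract_le b' x
      rw [ZSpan.fract_apply] at this
      refine this.trans ((Finset.sum_le_sum fun i _ => (hS _ (hb'S i)).2).trans ?_)
      simp [hcard]
    have hinj : Set.InjOn (fun v => l - v) (T : Set (Submodule.span ℤ (Set.range b))) := by
      intro a _ b _ h
      simpa using h
    calc (T.card : ℝ≥0∞) = ∑ g ∈ T.image (fun v => l - v), 
            (g +ᵥ E).indicator (fun _ => (1:ℝ≥0∞)) x := by
          rw [Finset.sum_image hinj, Finset.sum_congr rfl (g := fun _ => 1)]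
          · simp
          · intro v hv
            rw [Set.indicator_of_mem]
            refine ⟨(v : Fin k → ℝ) + (x - l), ?_, ?_⟩
            · rw [hE, mem_closedBall_iff_norm]
              calc ‖(v : Fin k → ℝ) + (x - l) - c‖ = ‖((v : Fin k → ℝ) - c) + (x - l)‖ := by
                    congr 1; abel
                _ ≤ _ := norm_add_le _ _
                _ ≤ _ := by linarith [hT v hv]
            · simp only [vadd_eq_add, Submodule.coe_sub]
              abel
      _ ≤ _ := ENNReal.sum_le_tsum _
  rw [hF, ZSpan.volume_fundamentalDomain, hE, Real.volume_pi_closedBall _ hr0] at h2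
  simp only [Fintype.card_fin] at h2
  rw [← ENNReal.ofReal_natCast, ← ENNReal.ofReal_mul (by positivity)] at h2
  exact (ENNReal.ofReal_le_ofReal_iff (by positivity)).1 h2

lemma aux_prod (d m : ℕ) (a b c : ℝ) :
    ∏ i : Fin (d + m + 1), (if (i : ℕ) < m then a else if (i : ℕ) < d + m then b else c)
      = a ^ m * b ^ d * c := by
  rw [Fin.prod_univ_eq_prod_range (fun i => if i < m then a else if i < d + m then b else c),
    Finset.prod_range_succ, add_comm d m, Finset.prod_range_add]
  rw [Finset.prod_congr rfl (g := fun _ => a), Finset.prod_congr (s₁ := Finset.range d) rfl (g := fun _ => b)]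
  · simp
  · intro x hx; simp at hx; simp [hx]
  · intro x hx; simp at hx; simp [hx]

lemma aux_norm_clm {d : ℕ} (L : (Fin d → ℝ) →L[ℝ] ℝ) (M : ℝ) (hM : 0 ≤ M)
    (h : ∀ i, |L (Pi.single i 1)| ≤ M) : ‖L‖ ≤ d * M := by
  refine L.opNorm_le_bound (by positivity) fun x => ?_
  have : L x = ∑ i, x i * L (Pi.single i 1) := by
    conv_lhs => rw [pi_eq_sum_univ' x]
    simp [map_sum]
  rw [this]
  refine (norm_sum_le _ _).trans ?_
  calc _ ≤ ∑ i : Fin d, ‖x‖ * M := by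
        refine Finset.sum_le_sum fun i _ => ?_
        rw [norm_mul]
        exact mul_le_mul (norm_le_pi_norm x i) (h i) (by positivity) (by positivity)
    _ = _ := by simp; ring
lemma aux_count_mat {k : ℕ} (g : Matrix (Fin k) (Fin k) ℝ) (hdet : g.det ≠ 0) (R K : ℝ)
    (hR : 0 < R) (hK : 0 ≤ K) (hs : succMin k g ≤ R) (c : Fin k → ℝ) (T : Finset (Fin k → ℤ))
    (hT : ∀ v ∈ T, ∀ i, |g.mulVec (fun j => (v j : ℝ)) i - c i| ≤ K * R) :
    (T.card : ℝ) * |g.det| ≤ (2 * ((K + k) * (2 * R))) ^ k := by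
  classical
  have hli : LinearIndependent ℝ g.col :=
    Matrix.linearIndependent_cols_iff_isUnit.2 ((Matrix.isUnit_iff_isUnit_det _).2 hdet.isUnit)
  set b := basisOfLinearIndependentOfCardEqFinrank' g.col hli (by simp) with hb
  have hbg : ⇑b = g.col := coe_basisOfLinearIndependentOfCardEqFinrank' g.col hli (by simp)
  have hmul : ∀ v : Fin k → ℤ, g.mulVec (fun j => (v j : ℝ)) = ∑ j, v j • b j := by
    intro v
    rw [Matrix.mulVec_eq_sum]
    refine Finset.sum_congr rfl fun j _ => ?_
    rw [hbg]
    ext i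
    simp [Matrix.col, mul_comm]
  have hmem : ∀ v : Fin k → ℤ, g.mulVec (fun j => (v j : ℝ)) ∈ Submodule.span ℤ (Set.range b) := by
    intro v
    rw [hmul]
    exact Submodule.sum_mem _ fun j _ => Submodule.smul_mem _ _ (Submodule.subset_span ⟨j, rfl⟩)
  have hinj : Function.Injective (fun v : Fin k → ℤ =>
      (⟨g.mulVec (fun j => (v j : ℝ)), hmem v⟩ : Submodule.span ℤ (Set.range b))) := by
    intro v w h
    have h1 : g.mulVec (fun j => (v j : ℝ)) = g.mulVec (fun j => (w j : ℝ)) := congrArg Subtype.val h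
    have h2 := Matrix.mulVec_injective_of_isUnit ((Matrix.isUnit_iff_isUnit_det _).2 hdet.isUnit) h1
    ext j
    exact_mod_cast congrFun h2 j
  -- successive minimum
  have hnorm : ∀ (w : Fin k → ℝ) (i : Fin k), |w i| ≤ Real.sqrt (∑ j, w j ^ 2) := by
    intro w i
    rw [← Real.sqrt_sq_eq_abs]
    exact Real.sqrt_le_sqrt (Finset.single_le_sum (f := fun j => w j ^ 2)
      (fun j _ => sq_nonneg _) (Finset.mem_univ i))
  have hne : {r : ℝ | 0 ≤ r ∧ k ≤ Module.finrank ℝ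
    (Submodule.span ℝ {w : Fin k → ℝ | (∃ v : Fin k → ℤ, v ≠ 0 ∧
      w = g.mulVec (fun j => (v j : ℝ))) ∧ Real.sqrt (∑ j, w j ^ 2) ≤ r})}.Nonempty := by
    refine ⟨∑ i, Real.sqrt (∑ j, (b i) j ^ 2), Finset.sum_nonneg fun i _ => Real.sqrt_nonneg _, ?_⟩
    have : Submodule.span ℝ {w : Fin k → ℝ | (∃ v : Fin k → ℤ, v ≠ 0 ∧
      w = g.mulVec (fun j => (v j : ℝ))) ∧ Real.sqrt (∑ j, w j ^ 2) ≤
        ∑ i, Real.sqrt (∑ j, (b i) j ^ 2)} = ⊤ := by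
      rw [eq_top_iff, ← b.span_eq]
      refine Submodule.span_mono ?_
      rintro _ ⟨i, rfl⟩
      refine ⟨⟨Pi.single i 1, by simp, ?_⟩, ?_⟩
      · rw [hmul, Finset.sum_eq_single i]
        · simp
        · intro j _ hj; simp [hj]
        · simp
      · exact Finset.single_le_sum (f := fun i => Real.sqrt (∑ j, (b i) j ^ 2))
          (fun j _ => Real.sqrt_nonneg _) (Finset.mem_univ i)
    rw [this]
    simp
  obtain ⟨r, ⟨hr0, hrk⟩, hr2⟩ := exists_lt_of_csInf_lt hne (lt_of_le_of_lt hs (by linarith : R < 2 * R))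
  have hcnt := aux_count_lattice b (2 * R) K (by linarith) hK (S := {w : Fin k → ℝ | (∃ v : Fin k → ℤ, v ≠ 0 ∧
      w = g.mulVec (fun j => (v j : ℝ))) ∧ Real.sqrt (∑ j, w j ^ 2) ≤ r}) ?_ ?_ c
      (T.image fun v => ⟨g.mulVec (fun j => (v j : ℝ)), hmem v⟩) ?_
  · rw [Finset.card_image_of_injective _ hinj] at hcnt
    have : (Matrix.of b) = g.transpose := by rw [hbg]; rfl
    rwa [this, Matrix.det_transpose] at hcnt
  · rintro w ⟨⟨v, -, rfl⟩, hw⟩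
    refine ⟨hmem v, (pi_norm_le_iff_of_nonneg (by linarith)).2 fun i => ?_⟩
    exact (hnorm _ i).trans (hw.trans hr2.le)
  · apply Submodule.eq_top_of_finrank_eq
    apply le_antisymm (Submodule.finrank_le _)
    simpa using hrk
  · intro v hv
    obtain ⟨w, hw, rfl⟩ := Finset.mem_image.1 hv
    refine (pi_norm_le_iff_of_nonneg (by positivity)).2 fun i => ?_
    have := hT w hw i
    simp only [Pi.sub_apply, Real.norm_eq_abs]
    nlinarith [mul_nonneg hK hR.le]

lemma aux_taylor {d m : ℕ} (U : Set (Fin d → ℝ)) (hU : IsOpen U)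
    (f : (Fin d → ℝ) → Fin m → ℝ) (hf : ContDiffOn ℝ 2 f U)
    (M : ℝ) (hM : 1 ≤ M)
    (hM2 : ∀ x ∈ U, ∀ i i' j : ℕ, |pd2 f i i' j x| ≤ M)
    (B : Set (Fin d → ℝ)) (hB : Convex ℝ B) (hBU : B ⊆ U) (x x0 : Fin d → ℝ) (hx : x ∈ B)
    (hx0 : x0 ∈ B) (j : Fin m) :
    |f x j - f x0 j - ∑ i : Fin d, pd1 f i j x0 * (x i - x0 i)| ≤ d ^ 2 * M * ‖x - x0‖ ^ 2 := by
  have hfj : ContDiffOn ℝ 2 (fun y => f y j) U := (contDiffOn_pi.1 hf) j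
  have hpd : ∀ i : Fin d, (fun y => pd1 f i j y) = fun y => fderiv ℝ (fun y => f y j) y (Pi.single i 1) := by
    intro i; ext y; simp [pd1]
  have hdf : ∀ y ∈ U, DifferentiableAt ℝ (fun y => f y j) y := fun y hy =>
    (hfj.contDiffAt (hU.mem_nhds hy)).differentiableAt (by norm_num)
  have hdf1 : ∀ i : Fin d, ∀ y ∈ U, DifferentiableAt ℝ (fun y => pd1 f i j y) y := by
    intro i y hy
    rw [hpd]
    have : ContDiffAt ℝ 1 (fderiv ℝ (fun y => f y j)) y :=
      (hfj.contDiffAt (hU.mem_nhds hy)).fderiv_right (by norm_num)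
    exact (this.differentiableAt (by norm_num)).clm_apply (differentiableAt_const _)
  have hb1 : ∀ i : Fin d, ∀ y ∈ B, |pd1 f i j y - pd1 f i j x0| ≤ d * M * ‖y - x0‖ := by
    intro i y hy
    refine hB.norm_image_sub_le_of_norm_fderiv_le (𝕜 := ℝ) (f := fun y => pd1 f i j y)
      (fun w hw => hdf1 i w (hBU hw)) (fun w hw => ?_) hx0 hy
    refine aux_norm_clm _ M (by linarith) fun i' => ?_
    have := hM2 w (hBU hw) i i' j
    simpa [pd2] using this
  have hlin : ∀ v : Fin d → ℝ, fderiv ℝ (fun y => f y j) x0 v = ∑ i : Fin d, pd1 f i j x0 * v i := by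
    intro v
    conv_lhs => rw [pi_eq_sum_univ' v]
    rw [map_sum]
    refine Finset.sum_congr rfl fun i _ => ?_
    rw [congrFun (hpd i) x0]
    rw [map_smul, smul_eq_mul, mul_comm]
  have := (hB.inter (convex_closedBall x0 ‖x - x0‖)).norm_image_sub_le_of_norm_fderiv_le' (𝕜 := ℝ)
    (f := fun y => f y j) (φ := fderiv ℝ (fun y => f y j) x0) (C := d * (d * M * ‖x - x0‖))
    (x := x0) (y := x)
    (fun w hw => hdf w (hBU hw.1)) (fun w hw => ?_) ⟨hx0, by simp⟩ ⟨hx, by simp [dist_eq_norm]⟩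
  · rw [hlin] at this
    calc _ ≤ _ := this
      _ = _ := by ring
  · refine aux_norm_clm _ _ (by positivity) fun i => ?_
    have h1 := hb1 i w hw.1
    rw [congrFun (hpd i) x0, congrFun (hpd i) w] at h1
    refine h1.trans ?_
    have : ‖w - x0‖ ≤ ‖x - x0‖ := by simpa [dist_eq_norm] using hw.2
    gcongr
lemma aux_u1_sum {d m : ℕ} (f : (Fin d → ℝ) → Fin m → ℝ) (x : Fin d → ℝ) (y : Fin (d + m) → ℝ)
    (s : ℝ) (r : Fin (d + m + 1)) :
    (u1Mat f x).mulVec (Fin.snoc (α := fun _ => ℝ) (fun c => - y (Fin.rev c)) s) r =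
      (∑ i : Fin d, u1Mat f x r (Fin.castSucc (Fin.rev (Fin.castAdd m i))) * (- y (Fin.castAdd m i)))
      + (∑ j : Fin m, u1Mat f x r (Fin.castSucc (Fin.rev (Fin.natAdd d j))) * (- y (Fin.natAdd d j)))
      + u1Mat f x r (Fin.last _) * s := by
  rw [Matrix.mulVec, dotProduct, Fin.sum_univ_castSucc]
  simp only [Fin.snoc_castSucc, Fin.snoc_last]
  congr 1
  rw [← Fin.sum_univ_add (fun i : Fin (d + m) => u1Mat f x r (Fin.castSucc (Fin.rev i)) * (- y i))]
  rw [← Equiv.sum_comp Fin.revPerm]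
  simp

lemma aux_u1_f {d m : ℕ} (f : (Fin d → ℝ) → Fin m → ℝ) (x : Fin d → ℝ) (y : Fin (d + m) → ℝ)
    (s : ℝ) (j : Fin m) :
    (u1Mat f x).mulVec (Fin.snoc (α := fun _ => ℝ) (fun c => - y (Fin.rev c)) s)
      (Fin.castSucc (Fin.rev (Fin.natAdd d j))) =
    s * f x j - y (Fin.natAdd d j)
      - ∑ i : Fin d, pd1 f i j x * (s * x i - y (Fin.castAdd m i)) := by
  rw [aux_u1_sum]
  have h1 : ∀ i : Fin d, u1Mat f x (Fin.castSucc (Fin.rev (Fin.natAdd d j)))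
      (Fin.castSucc (Fin.rev (Fin.castAdd m i))) = - pd1 f i j x := by
    intro i
    have hi := i.isLt
    have hj := j.isLt
    unfold u1Mat
    simp only [Fin.val_castSucc, Fin.val_rev, Fin.val_natAdd, Fin.val_castAdd]
    rw [if_neg (by omega), if_pos (by omega)]
    congr 2 <;> omega
  have h2 : ∀ j' : Fin m, u1Mat f x (Fin.castSucc (Fin.rev (Fin.natAdd d j)))
      (Fin.castSucc (Fin.rev (Fin.natAdd d j'))) = if j' = j then 1 else 0 := by
    intro j'
    have hj := j.isLt
    have hj' := j'.isLt
    unfold u1Mat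
    simp only [Fin.val_castSucc, Fin.val_rev, Fin.val_natAdd, Fin.ext_iff]
    by_cases h : (j' : ℕ) = j
    · rw [if_pos (by omega), if_pos h]
    · rw [if_neg (by omega), if_neg (by omega), if_neg (by omega), if_neg (by omega), if_neg h]
  have h3 : u1Mat f x (Fin.castSucc (Fin.rev (Fin.natAdd d j))) (Fin.last _) =
      f x j - ∑ i : Fin d, x i * pd1 f i j x := by
    have hj := j.isLt
    unfold u1Mat
    simp only [Fin.val_castSucc, Fin.val_rev, Fin.val_natAdd, Fin.val_last]
    have e : m - 1 - (d + m - (d + (j : ℕ) + 1)) = j := by omega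
    rw [if_neg (by omega), if_neg (by omega), if_pos ⟨by omega, by trivial⟩]
    simp [e]
  simp only [h1, h2, h3]
  simp only [ite_mul, one_mul, zero_mul, Finset.sum_ite_eq', Finset.mem_univ, if_true, sub_mul, mul_sub,
    Finset.sum_sub_distrib, Finset.sum_mul, neg_mul_neg]
  have : ∑ i : Fin d, x i * pd1 f i j x * s = ∑ i : Fin d, pd1 f i j x * (s * x i) :=
    Finset.sum_congr rfl fun i _ => by ring
  rw [this]
  ring

lemma aux_u1_x {d m : ℕ} (f : (Fin d → ℝ) → Fin m → ℝ) (x : Fin d → ℝ) (y : Fin (d + m) → ℝ)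
    (s : ℝ) (i : Fin d) :
    (u1Mat f x).mulVec (Fin.snoc (α := fun _ => ℝ) (fun c => - y (Fin.rev c)) s)
      (Fin.castSucc (Fin.rev (Fin.castAdd m i))) = s * x i - y (Fin.castAdd m i) := by
  rw [aux_u1_sum]
  have hi := i.isLt
  have h1 : ∀ i' : Fin d, u1Mat f x (Fin.castSucc (Fin.rev (Fin.castAdd m i)))
      (Fin.castSucc (Fin.rev (Fin.castAdd m i'))) = if i' = i then 1 else 0 := by
    intro i'
    have hi' := i'.isLt
    unfold u1Mat
    simp only [Fin.val_castSucc, Fin.val_rev, Fin.val_castAdd, Fin.ext_iff]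
    by_cases h : (i' : ℕ) = i
    · rw [if_pos (by omega), if_pos h]
    · rw [if_neg (by omega), if_neg (by omega), if_neg (by omega), if_neg (by omega), if_neg h]
  have h2 : ∀ j' : Fin m, u1Mat f x (Fin.castSucc (Fin.rev (Fin.castAdd m i)))
      (Fin.castSucc (Fin.rev (Fin.natAdd d j'))) = 0 := by
    intro j'
    have hj' := j'.isLt
    unfold u1Mat
    simp only [Fin.val_castSucc, Fin.val_rev, Fin.val_castAdd, Fin.val_natAdd]
    rw [if_neg (by omega), if_neg (by omega), if_neg (by omega), if_neg (by omega)]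
  have h3 : u1Mat f x (Fin.castSucc (Fin.rev (Fin.castAdd m i))) (Fin.last _) = x i := by
    unfold u1Mat
    simp only [Fin.val_castSucc, Fin.val_rev, Fin.val_castAdd, Fin.val_last]
    have e : d + m - 1 - (d + m - ((i : ℕ) + 1)) = i := by omega
    rw [if_neg (by omega), if_neg (by omega), if_neg (by omega), if_pos ⟨by omega, by omega, by trivial⟩]
    simp [e]
  simp only [h1, h2, h3]
  simp
  ring

lemma aux_u1_last {d m : ℕ} (f : (Fin d → ℝ) → Fin m → ℝ) (x : Fin d → ℝ) (y : Fin (d + m) → ℝ)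
    (s : ℝ) :
    (u1Mat f x).mulVec (Fin.snoc (α := fun _ => ℝ) (fun c => - y (Fin.rev c)) s) (Fin.last _) = s := by
  rw [Matrix.mulVec, dotProduct, Fin.sum_univ_castSucc]
  have h : ∀ c : Fin (d + m), u1Mat f x (Fin.last _) c.castSucc = 0 := by
    intro c
    have hc := c.isLt
    unfold u1Mat
    simp only [Fin.val_castSucc, Fin.val_last]
    rw [if_neg (by omega), if_neg (by omega), if_neg (by omega), if_neg (by omega)]
  have h' : u1Mat f x (Fin.last _) (Fin.last _) = 1 := by simp [u1Mat]
  simp [h, h']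

lemma aux_u1_det {d m : ℕ} (f : (Fin d → ℝ) → Fin m → ℝ) (x : Fin d → ℝ) :
    (u1Mat f x).det = 1 := by
  rw [Matrix.det_of_isUpperTriangular]
  · simp [u1Mat]
  · intro r c hrc
    have hrc' : (c : ℕ) < r := hrc
    have hr := r.isLt
    unfold u1Mat
    rw [if_neg (by omega), if_neg (by omega), if_neg (by omega), if_neg (by omega)]

lemma aux_diag (d m : ℕ) (ε t : ℝ) (hε : 0 < ε) :
    ∃ R α β γ : ℝ, 0 < R ∧ R = phiC d m ε t * Real.exp (hC d m t) ∧ 0 < α ∧ 0 < β ∧ 0 < γ ∧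
      α * ε = R ∧ β * (Real.sqrt ε * Real.exp (t / 2)) = R ∧ γ * Real.exp t = R ∧
      dMat d m ε * bMat d m t * gMat d m ε t = Matrix.diagonal
        (fun i : Fin (d + m + 1) => if (i : ℕ) < m then α else if (i : ℕ) < d + m then β else γ) := by
  have hφ : 0 < phiC d m ε t := by unfold phiC; positivity
  refine ⟨phiC d m ε t * Real.exp (hC d m t), 1 * Real.exp (hC d m t) * (phiC d m ε t * ε⁻¹),
    Real.sqrt ε * Real.exp (-(((m : ℝ) + 1) * t) / (2 * ((d : ℝ) + m + 1))) * (phiC d m ε t * ε⁻¹),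
    1 * Real.exp (hC d m t) * (phiC d m ε t * Real.exp (-t)), by positivity, rfl, by positivity,
    by positivity, by positivity, ?_, ?_, ?_, ?_⟩
  · field_simp
  · have h1 : Real.exp (-(((m : ℝ) + 1) * t) / (2 * ((d : ℝ) + m + 1))) * Real.exp (t / 2)
        = Real.exp (hC d m t) := by
      rw [← Real.exp_add, hC]
      congr 1
      field_simp
      ring
    rw [← h1]
    have h2 : Real.sqrt ε * Real.sqrt ε = ε := Real.mul_self_sqrt hε.le
    calc _ = (Real.sqrt ε * Real.sqrt ε) * ε⁻¹ * phiC d m ε t *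
        (Real.exp (-(((m : ℝ) + 1) * t) / (2 * ((d : ℝ) + m + 1))) * Real.exp (t / 2)) := by ring
      _ = _ := by rw [h2, mul_inv_cancel₀ hε.ne', one_mul]
  · rw [Real.exp_neg]
    field_simp
  · unfold dMat bMat gMat
    rw [Matrix.diagonal_mul_diagonal, Matrix.diagonal_mul_diagonal]
    congr 1
    ext i
    by_cases h1 : (i : ℕ) < m
    · simp [h1, show (i : ℕ) < d + m by omega]
    · by_cases h2 : (i : ℕ) < d + m
      · simp [h1, h2]
      · simp [h1, h2]
lemma aux_fiber {d m : ℕ}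
    (U : Set (Fin d → ℝ)) (hU : IsOpen U)
    (f : (Fin d → ℝ) → Fin m → ℝ) (hf : ContDiffOn ℝ 2 f U)
    (M : ℝ) (hM : 1 ≤ M)
    (hM1 : ∀ x ∈ U, ∀ i j : ℕ, |pd1 f i j x| ≤ M)
    (hM2 : ∀ x ∈ U, ∀ i i' j : ℕ, |pd2 f i i' j x| ≤ M)
    (θ : Fin (d + m) → ℝ) (ε t : ℝ) (hε : 0 < ε) (hε1 : ε < 1) (ht : 0 ≤ t)
    (B : Set (Fin d → ℝ)) (hB : Convex ℝ B) (hBU : B ⊆ U) (x0 : Fin d → ℝ) (hx0 : x0 ∈ B)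
    (hx0M : x0 ∉ M0frak U f ε t) (S : Finset ((Fin (d + m) → ℤ) × ℤ))
    (hS : ∀ pq ∈ S, 1 ≤ pq.2 ∧ (pq.2 : ℝ) ≤ Real.exp t ∧ ∃ x ∈ B,
      ‖x - x0‖ ≤ Real.sqrt ε * Real.exp (-t / 2) ∧
      ∀ i, |fullMap d m f x i - ((pq.1 i : ℝ) + θ i) / (pq.2 : ℝ)| ≤ 2 * ε / Real.exp t) :
    (S.card : ℝ) ≤ (4 * ((3 + 2 * d * M + d ^ 2 * M) + (d + m + 1))) ^ (d + m + 1) *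
      (ε ^ m * (Real.sqrt ε * Real.exp (t / 2)) ^ d * Real.exp t) := by
  classical
  obtain ⟨R, α, β, γ, hR, hReq, hα, hβ, hγ, hα', hβ', hγ', hdiag⟩ := aux_diag d m ε t hε
  set D : Fin (d + m + 1) → ℝ :=
    fun i => if (i : ℕ) < m then α else if (i : ℕ) < d + m then β else γ with hD
  set A := dMat d m ε * bMat d m t * gMat d m ε t * u1Mat f x0 with hA
  have hAdet : A.det = α ^ m * β ^ d * γ := by
    rw [hA, hdiag, Matrix.det_mul, aux_u1_det, Matrix.det_diagonal, mul_one, aux_prod]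
  have hdetpos : 0 < α ^ m * β ^ d * γ := by positivity
  have hAmul : ∀ w r, A.mulVec w r = D r * (u1Mat f x0).mulVec w r := by
    intro w r
    rw [hA, hdiag, ← Matrix.mulVec_mulVec, Matrix.mulVec_diagonal]
  have hsm : succMin (d + m + 1) A ≤ R := by
    rw [hReq]
    by_contra hcon
    exact hx0M ⟨hBU hx0, not_le.1 hcon⟩
  set K : ℝ := 3 + 2 * d * M + d ^ 2 * M with hK
  have hM0 : 0 ≤ M := by linarith
  have hK0 : 0 ≤ K := by positivity
  have hdM : 0 ≤ (d : ℝ) * M := by positivity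
  have hd2M : 0 ≤ (d : ℝ) ^ 2 * M := by positivity
  have hs0 : 0 < Real.sqrt ε := Real.sqrt_pos.2 hε
  have hsq : Real.sqrt ε * Real.sqrt ε = ε := Real.mul_self_sqrt hε.le
  have het : Real.exp (t / 2) * Real.exp (t / 2) = Real.exp t := by
    rw [← Real.exp_add]; congr 1; ring
  have het2 : Real.exp t * Real.exp (-t / 2) = Real.exp (t / 2) := by
    rw [← Real.exp_add]; congr 1; ring
  have het3 : Real.exp t * (Real.exp (-t / 2) * Real.exp (-t / 2)) = 1 := by
    rw [← Real.exp_add, ← Real.exp_add, ← Real.exp_zero]; congr 1; ring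
  have he1 : 1 ≤ Real.exp (t / 2) := Real.one_le_exp (by linarith)
  have hes : ε ≤ Real.sqrt ε * Real.exp (t / 2) := by
    have : Real.sqrt ε ≤ 1 := Real.sqrt_le_one.2 hε1.le
    nlinarith
  set V : (Fin (d + m) → ℤ) × ℤ → (Fin (d + m + 1) → ℤ) :=
    fun pq => Fin.snoc (α := fun _ => ℤ) (fun c => - pq.1 (Fin.rev c)) pq.2 with hV
  have hVinj : Function.Injective V := by
    intro a b hab
    have h1 := congrFun hab (Fin.last _)
    have h2 : ∀ c : Fin (d + m), V a c.castSucc = V b c.castSucc := fun c => congrFun hab _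
    simp only [hV, Fin.snoc_last] at h1
    simp only [hV, Fin.snoc_castSucc, neg_inj] at h2
    refine Prod.ext (funext fun i => ?_) h1
    simpa using h2 (Fin.rev i)
  have hVcast : ∀ pq, (fun j => ((V pq j : ℤ) : ℝ)) =
      (Fin.snoc (α := fun _ => ℝ) (fun c => - (fun i => (pq.1 i : ℝ) + θ i) (Fin.rev c)) (pq.2 : ℝ)) +
      (Fin.snoc (α := fun _ => ℝ) (fun c => θ (Fin.rev c)) 0) := by
    intro pq
    ext j
    refine Fin.lastCases ?_ (fun c => ?_) j
    · simp [hV]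
    · simp [hV]
  have hcount := aux_count_mat A (by rw [hAdet]; exact hdetpos.ne') R K hR hK0 hsm
    (A.mulVec (Fin.snoc (α := fun _ => ℝ) (fun c => θ (Fin.rev c)) 0)) (S.image V) ?_
  · rw [Finset.card_image_of_injective _ hVinj, hAdet, abs_of_pos hdetpos] at hcount
    have hRk : R ^ (d + m + 1) = (α ^ m * β ^ d * γ) *
        (ε ^ m * (Real.sqrt ε * Real.exp (t / 2)) ^ d * Real.exp t) := by
      calc R ^ (d + m + 1) = R ^ m * R ^ d * R := by ring
        _ = (α * ε) ^ m * (β * (Real.sqrt ε * Real.exp (t / 2))) ^ d * (γ * Real.exp t) := by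
            rw [hα', hβ', hγ']
        _ = _ := by rw [mul_pow, mul_pow]; ring
    refine le_of_mul_le_mul_right (hcount.trans (le_of_eq ?_)) hdetpos
    push_cast
    rw [show 2 * ((K + ((d : ℝ) + m + 1)) * (2 * R)) = (4 * (K + ((d : ℝ) + m + 1))) * R by ring,
      mul_pow, hRk]
    ring
  · intro v hv r
    obtain ⟨pq, hpq, rfl⟩ := Finset.mem_image.1 hv
    obtain ⟨hq1, hqt, x, hx, hxx0, hxf⟩ := hS pq hpq
    rw [hVcast, Matrix.mulVec_add, Pi.add_apply, add_sub_cancel_right, hAmul]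
    set q : ℝ := (pq.2 : ℝ) with hq
    have hq0 : 0 < q := by
      have : (1 : ℝ) ≤ q := by rw [hq]; exact_mod_cast hq1
      linarith
    set P : Fin (d + m) → ℝ := fun i => (pq.1 i : ℝ) + θ i with hP
    have hqb : ∀ i, |q * fullMap d m f x i - P i| ≤ 2 * ε := by
      intro i
      have h1 : q * fullMap d m f x i - P i = q * (fullMap d m f x i - P i / q) := by
        field_simp
      rw [h1, abs_mul, abs_of_pos hq0]
      calc q * |fullMap d m f x i - P i / q| ≤ Real.exp t * (2 * ε / Real.exp t) :=
            mul_le_mul hqt (hxf i) (abs_nonneg _) (Real.exp_pos _).le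
        _ = 2 * ε := by field_simp
    have hqx : ∀ i : Fin d, |q * x i - P (Fin.castAdd m i)| ≤ 2 * ε := by
      intro i
      simpa [fullMap] using hqb (Fin.castAdd m i)
    have hqf : ∀ j : Fin m, |q * f x j - P (Fin.natAdd d j)| ≤ 2 * ε := by
      intro j
      simpa [fullMap] using hqb (Fin.natAdd d j)
    refine Fin.lastCases ?_ (fun c => ?_) r
    · rw [aux_u1_last]
      have : D (Fin.last _) = γ := by simp [hD]
      rw [this, abs_of_pos (by positivity)]
      calc γ * q ≤ γ * Real.exp t := by gcongr
        _ = R := hγ'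
        _ ≤ K * R := by nlinarith
    · obtain ⟨c, rfl⟩ := Fin.rev_surjective c
      refine Fin.addCases (fun i => ?_) (fun j => ?_) c
      · rw [aux_u1_x]
        have hi := i.isLt
        have : D (Fin.castSucc (Fin.rev (Fin.castAdd m i))) = β := by
          simp only [hD, Fin.val_castSucc, Fin.val_rev, Fin.val_castAdd]
          rw [if_neg (by omega), if_pos (by omega)]
        rw [this, abs_mul, abs_of_pos hβ]
        have h1 : |q * (x i - x0 i)| ≤ Real.sqrt ε * Real.exp (t / 2) := by
          rw [abs_mul, abs_of_pos hq0]
          calc q * |x i - x0 i| ≤ Real.exp t * (Real.sqrt ε * Real.exp (-t / 2)) :=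
                mul_le_mul hqt ((norm_le_pi_norm (x - x0) i).trans hxx0) (abs_nonneg _)
                  (Real.exp_pos _).le
            _ = Real.sqrt ε * (Real.exp t * Real.exp (-t / 2)) := by ring
            _ = _ := by rw [het2]
        have h2 : |q * x0 i - P (Fin.castAdd m i)| ≤ 3 * (Real.sqrt ε * Real.exp (t / 2)) := by
          have h3 : q * x0 i - P (Fin.castAdd m i) =
            (q * x i - P (Fin.castAdd m i)) - q * (x i - x0 i) := by ring
          rw [h3]
          refine (abs_sub _ _).trans ?_
          linarith [hqx i]
        calc β * |q * x0 i - P (Fin.castAdd m i)| ≤ β * (3 * (Real.sqrt ε * Real.exp (t / 2))) := by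
              gcongr
          _ = 3 * R := by rw [← hβ']; ring
          _ ≤ K * R := by
              apply mul_le_mul_of_nonneg_right _ hR.le
              rw [hK]; nlinarith
      · rw [aux_u1_f]
        have hj := j.isLt
        have : D (Fin.castSucc (Fin.rev (Fin.natAdd d j))) = α := by
          simp only [hD, Fin.val_castSucc, Fin.val_rev, Fin.val_natAdd]
          rw [if_pos (by omega)]
        rw [this, abs_mul, abs_of_pos hα]
        have hT := aux_taylor U hU f hf M hM hM2 B hB hBU x x0 hx hx0 j
        have hxs : ‖x - x0‖ ^ 2 ≤ ε * (Real.exp (-t / 2) * Real.exp (-t / 2)) := by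
          calc ‖x - x0‖ ^ 2 ≤ (Real.sqrt ε * Real.exp (-t / 2)) ^ 2 := by gcongr
            _ = (Real.sqrt ε * Real.sqrt ε) * (Real.exp (-t / 2) * Real.exp (-t / 2)) := by ring
            _ = _ := by rw [hsq]
        have h1 : |q * (f x j - f x0 j - ∑ i : Fin d, pd1 f i j x0 * (x i - x0 i))|
            ≤ d ^ 2 * M * ε := by
          rw [abs_mul, abs_of_pos hq0]
          calc _ ≤ Real.exp t * (d ^ 2 * M * (ε * (Real.exp (-t / 2) * Real.exp (-t / 2)))) :=
                mul_le_mul hqt (hT.trans (by gcongr)) (abs_nonneg _) (Real.exp_pos _).le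
            _ = d ^ 2 * M * ε * (Real.exp t * (Real.exp (-t / 2) * Real.exp (-t / 2))) := by ring
            _ = _ := by rw [het3, mul_one]
        have h2 : |∑ i : Fin d, pd1 f i j x0 * (q * x i - P (Fin.castAdd m i))| ≤ d * (M * (2 * ε)) := by
          refine (Finset.abs_sum_le_sum_abs _ _).trans ?_
          calc _ ≤ ∑ i : Fin d, M * (2 * ε) := by
                refine Finset.sum_le_sum fun i _ => ?_
                rw [abs_mul]
                exact mul_le_mul (hM1 x0 (hBU hx0) i j) (hqx i) (abs_nonneg _) hM0
            _ = _ := by simp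
        have h3 : q * f x0 j - P (Fin.natAdd d j)
            - ∑ i : Fin d, pd1 f i j x0 * (q * x0 i - P (Fin.castAdd m i))
            = (q * f x j - P (Fin.natAdd d j))
              - q * (f x j - f x0 j - ∑ i : Fin d, pd1 f i j x0 * (x i - x0 i))
              - ∑ i : Fin d, pd1 f i j x0 * (q * x i - P (Fin.castAdd m i)) := by
          have : ∑ i : Fin d, pd1 f i j x0 * (q * x i - P (Fin.castAdd m i))
              = ∑ i : Fin d, pd1 f i j x0 * (q * x0 i - P (Fin.castAdd m i))
                + q * ∑ i : Fin d, pd1 f i j x0 * (x i - x0 i) := by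
            rw [Finset.mul_sum, ← Finset.sum_add_distrib]
            exact Finset.sum_congr rfl fun i _ => by ring
          rw [this]; ring
        have h4 : |q * f x0 j - P (Fin.natAdd d j)
            - ∑ i : Fin d, pd1 f i j x0 * (q * x0 i - P (Fin.castAdd m i))| ≤ K * ε := by
          rw [h3]
          refine (abs_sub _ _).trans ?_
          have := abs_sub (q * f x j - P (Fin.natAdd d j))
            (q * (f x j - f x0 j - ∑ i : Fin d, pd1 f i j x0 * (x i - x0 i)))
          rw [hK]
          linarith [hqf j]
        calc _ ≤ α * (K * ε) := by gcongr
          _ = K * R := by rw [← hα']; ring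
/-- **Counting in the generic part** (Proposition 6.8). -/
theorem generic_part_count
    {d m : ℕ} (hd : 0 < d) (hm : 0 < m)
    (U : Set (Fin d → ℝ)) (hU : IsOpen U)
    (f : (Fin d → ℝ) → Fin m → ℝ) (hf : ContDiffOn ℝ 2 f U)
    (M : ℝ) (hM : 1 ≤ M)
    (hM1 : ∀ x ∈ U, ∀ i j : ℕ, |pd1 f i j x| ≤ M)
    (hM2 : ∀ x ∈ U, ∀ i i' j : ℕ, |pd2 f i i' j x| ≤ M)
    (θ : Fin (d + m) → ℝ) :
    ∃ C : ℝ, 0 < C ∧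
      ∀ ε : ℝ, 0 < ε → ε < 1 →
      ∀ z : Fin d → ℝ, ∀ rB : ℝ, 0 < rB → Metric.ball z rB ⊆ U →
        ∃ t₀ : ℝ, ∀ t : ℝ, t₀ ≤ t →
          (Nfull (fullMap d m f) θ (Metric.ball z rB \ Mfrak U f ε t) ε t : ℝ) ≤
            C * ε ^ m * Real.exp (((d : ℝ) + 1) * t) *
              (volume (Metric.ball z rB)).toReal := by
  have hM0 : 0 ≤ M := by linarith
  set X : ℝ := (4 * ((3 + 2 * d * M + d ^ 2 * M) + (d + m + 1))) ^ (d + m + 1) with hX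
  have hX0 : 0 < X := by positivity
  refine ⟨X * 2 ^ d, by positivity, ?_⟩
  intro ε hε hε1 z rB hrB hBU
  refine ⟨max 0 (-2 * Real.log rB), fun t ht => ?_⟩
  have ht0 : 0 ≤ t := (le_max_left _ _).trans ht
  have htr : Real.exp (-t / 2) ≤ rB := by
    rw [← Real.le_log_iff_exp_le hrB]
    linarith [(le_max_right 0 (-2 * Real.log rB)).trans ht]
  classical
  set B := Metric.ball z rB with hB
  set Δ := B \ Mfrak U f ε t with hΔ
  have hs0 : 0 < Real.sqrt ε := Real.sqrt_pos.2 hε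
  set ρ := Real.sqrt ε * Real.exp (-t / 2) with hρ
  have hρ0 : 0 < ρ := by positivity
  have hρr : ρ ≤ rB := by
    have : Real.sqrt ε ≤ 1 := Real.sqrt_le_one.2 hε1.le
    nlinarith [Real.exp_pos (-t / 2)]
  have hvol : (volume B).toReal = (2 * rB) ^ d := by
    rw [hB, Real.volume_pi_ball _ hrB, ENNReal.toReal_ofReal (by positivity)]
    simp
  rw [hvol]
  have hRHS : 0 ≤ X * 2 ^ d * ε ^ m * Real.exp (((d : ℝ) + 1) * t) * (2 * rB) ^ d := by positivity
  have hΔM0 : ∀ x ∈ Δ, x ∉ M0frak U f ε t := by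
    intro x hx hxM
    refine hx.2 ⟨?_, hBU hx.1⟩
    simp only [Set.mem_iUnion]
    exact ⟨x, hxM, Metric.mem_ball_self (by positivity)⟩
  by_cases hne : Δ.Nonempty
  swap
  · have : NfullSet (fullMap d m f) θ Δ ε t = {pq | 1 ≤ pq.2 ∧ (pq.2 : ℝ) ≤ Real.exp t} := by
      rw [Set.not_nonempty_iff_eq_empty] at hne
      ext pq
      simp only [NfullSet, hne, Set.image_empty, Real.sInf_empty, Set.mem_ofPred_eq]
      have : 0 ≤ ε / Real.exp t := by positivity
      tauto
    have hinf : (NfullSet (fullMap d m f) θ Δ ε t).Infinite := by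
      rw [this]
      have : Nonempty (Fin (d + m)) := ⟨⟨0, by omega⟩⟩
      refine Set.infinite_of_injective_forall_mem
        (f := fun p : Fin (d + m) → ℤ => (p, (1 : ℤ))) (fun a b h => (Prod.ext_iff.1 h).1) ?_
      intro p
      simpa using ht0
    rw [Nfull, hinf.ncard]
    simpa using hRHS
  by_cases hfin : (NfullSet (fullMap d m f) θ Δ ε t).Finite
  swap
  · rw [Nfull, Set.Infinite.ncard hfin]
    simpa using hRHS
  rw [Nfull, Set.ncard_eq_toFinset_card _ hfin]
  set N := hfin.toFinset with hN
  have hex : ∀ pq : (Fin (d + m) → ℤ) × ℤ, ∃ x : Fin d → ℝ, pq ∈ N → x ∈ Δ ∧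
      ∀ i, |fullMap d m f x i - ((pq.1 i : ℝ) + θ i) / (pq.2 : ℝ)| ≤ 2 * ε / Real.exp t := by
    intro pq
    by_cases hpq : pq ∈ N
    swap
    · exact ⟨0, fun h => absurd h hpq⟩
    have hmem : pq ∈ NfullSet (fullMap d m f) θ Δ ε t := hfin.mem_toFinset.1 hpq
    have hlt : ε / Real.exp t < 2 * ε / Real.exp t := by
      gcongr; linarith
    obtain ⟨_, ⟨x, hx, rfl⟩, hx2⟩ := exists_lt_of_csInf_lt (hne.image _) (hmem.2.2.trans_lt hlt)
    refine ⟨x, fun _ => ⟨hx, fun i => ?_⟩⟩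
    exact (norm_le_pi_norm (fun i => fullMap d m f x i - ((pq.1 i : ℝ) + θ i) / (pq.2 : ℝ)) i).trans
      hx2.le
  choose x hx using hex
  set cell : (Fin (d + m) → ℤ) × ℤ → (Fin d → ℤ) := fun pq i => ⌊x pq i / ρ⌋ with hcell
  set I : Finset (Fin d → ℤ) := Fintype.piFinset
    (fun i => Finset.Icc ⌊(z i - rB) / ρ⌋ ⌊(z i + rB) / ρ⌋) with hI
  have hmaps : ∀ pq ∈ N, cell pq ∈ I := by
    intro pq hpq
    have h1 : x pq ∈ B := (hx pq hpq).1.1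
    rw [hI, Fintype.mem_piFinset]
    intro i
    have h2 : |x pq i - z i| < rB := by
      rw [hB, mem_ball_iff_norm] at h1
      exact (norm_le_pi_norm (x pq - z) i).trans_lt h1
    rw [abs_lt] at h2
    rw [Finset.mem_Icc]
    constructor
    · apply Int.floor_le_floor
      gcongr
      linarith
    · apply Int.floor_le_floor
      gcongr
      linarith
  have hIcard : (I.card : ℝ) ≤ (4 * rB / ρ) ^ d := by
    rw [hI, Fintype.card_piFinset]
    push_cast
    calc _ ≤ ∏ i : Fin d, (4 * rB / ρ) := by
          refine Finset.prod_le_prod (fun i _ => by positivity) fun i _ => ?_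
          rw [Int.card_Icc]
          have h1 : ⌊(z i - rB) / ρ⌋ ≤ ⌊(z i + rB) / ρ⌋ := by
            apply Int.floor_le_floor
            gcongr
            linarith
          have h2 : (((⌊(z i + rB) / ρ⌋ + 1 - ⌊(z i - rB) / ρ⌋).toNat : ℤ) : ℝ) =
              ((⌊(z i + rB) / ρ⌋ + 1 - ⌊(z i - rB) / ρ⌋ : ℤ) : ℝ) := by
            rw [Int.toNat_of_nonneg (by omega)]
          rw [Int.cast_natCast] at h2
          rw [h2]
          push_cast
          have h3 := Int.floor_le ((z i + rB) / ρ)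
          have h4 := Int.lt_floor_add_one ((z i - rB) / ρ)
          have h5 : 1 ≤ rB / ρ := (one_le_div hρ0).2 hρr
          have h6 : (z i + rB) / ρ - (z i - rB) / ρ = 2 * (rB / ρ) := by ring
          have h7 : 4 * rB / ρ = 4 * (rB / ρ) := by ring
          rw [h7]
          linarith
      _ = _ := by rw [Finset.prod_const, Finset.card_univ, Fintype.card_fin]
  set Y : ℝ := X * (ε ^ m * (Real.sqrt ε * Real.exp (t / 2)) ^ d * Real.exp t) with hY
  have hY0 : 0 ≤ Y := by positivity
  have hfib : ∀ a ∈ I, (({pq ∈ N | cell pq = a} : Finset _).card : ℝ) ≤ Y := by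
    intro a _
    by_cases hemp : ({pq ∈ N | cell pq = a} : Finset _).Nonempty
    swap
    · rw [Finset.not_nonempty_iff_eq_empty.1 hemp]
      simpa using hY0
    obtain ⟨pq0, hpq0⟩ := hemp
    rw [Finset.mem_filter] at hpq0
    refine aux_fiber U hU f hf M hM hM1 hM2 θ ε t hε hε1 ht0 B (convex_ball z rB) hBU (x pq0)
      (hx pq0 hpq0.1).1.1 (hΔM0 _ (hx pq0 hpq0.1).1) _ ?_
    intro pq hpq
    rw [Finset.mem_filter] at hpq
    have hmem : pq ∈ NfullSet (fullMap d m f) θ Δ ε t := hfin.mem_toFinset.1 hpq.1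
    refine ⟨hmem.1, hmem.2.1, x pq, (hx pq hpq.1).1.1, ?_, (hx pq hpq.1).2⟩
    rw [pi_norm_le_iff_of_nonneg hρ0.le]
    intro i
    have h1 : ⌊x pq i / ρ⌋ = ⌊x pq0 i / ρ⌋ := by
      have := hpq.2.trans hpq0.2.symm
      exact congrFun this i
    have h2 := Int.abs_sub_lt_one_of_floor_eq_floor h1
    rw [← sub_div, abs_div, abs_of_pos hρ0, div_lt_one hρ0] at h2
    exact h2.le
  have hmain : (N.card : ℝ) ≤ I.card * Y := by
    rw [Finset.card_eq_sum_card_fiberwise hmaps]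
    push_cast
    refine (Finset.sum_le_sum hfib).trans ?_
    simp
  refine hmain.trans ((mul_le_mul_of_nonneg_right hIcard hY0).trans (le_of_eq ?_))
  have e1 : Real.exp (((d : ℝ) + 1) * t) = Real.exp (t / 2) ^ d * Real.exp (t / 2) ^ d * Real.exp t := by
    rw [← Real.exp_nat_mul, ← Real.exp_add, ← Real.exp_add]
    congr 1
    ring
  have e2 : ρ = Real.sqrt ε / Real.exp (t / 2) := by
    rw [hρ, div_eq_mul_inv (Real.sqrt ε), ← Real.exp_neg]
    congr 2
    ring
  rw [e1, hY, e2]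
  have e3 : (4 * rB / (Real.sqrt ε / Real.exp (t / 2))) ^ d * (Real.sqrt ε * Real.exp (t / 2)) ^ d
      = 2 ^ d * (2 * rB) ^ d * (Real.exp (t / 2) ^ d * Real.exp (t / 2) ^ d) := by
    rw [← mul_pow, ← mul_pow, ← mul_pow, ← mul_pow]
    congr 1
    field_simp
    ring
  calc _ = X * ε ^ m * Real.exp t * ((4 * rB / (Real.sqrt ε / Real.exp (t / 2))) ^ d *
        (Real.sqrt ε * Real.exp (t / 2)) ^ d) := by ring
    _ = _ := by rw [e3]; ring
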